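/- Let x ∈ ℝ^d with ‖x‖ = N_x, let p_y ∈ ℝ^d and a finite nonempty set Z of indices with proxies p_z ∈ ℝ^d such that ‖p_y‖ = ‖p_z‖ = N_p for all z ∈ Z, and suppose β := 1/(N_x · N_p) satisfies 0 < β ≤ 1. Then L_NCA(x̂, p̂_y, p̂_Z) ≤ β · L_NCA(x, p_y, p_Z) + (1 − β) · log|Z|, where x̂ = x/‖x‖, p̂ = p/‖p‖, and p_Z = {p_z : z ∈ Z}. -/

import Mathlib

/-- The NCA loss of an anchor `x`, positive `y`, and finite set of negatives given by
the image (with multiplicity) of the index set `Z` under `f`: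
`L_NCA(x, y, f(Z)) = −log( exp(−½‖x − y‖²) / Σ_{z∈Z} exp(−½‖x − f z‖²) )`. -/
noncomputable def LNCA {d : ℕ} {ι : Type*} (x y : EuclideanSpace ℝ (Fin d))
    (Z : Finset ι) (f : ι → EuclideanSpace ℝ (Fin d)) : ℝ :=
  -Real.log
    (Real.exp (-(1 / 2) * ‖x - y‖ ^ 2) / ∑ z ∈ Z, Real.exp (-(1 / 2) * ‖x - f z‖ ^ 2))

/-- When the positive and all negatives have the same norm, the NCA loss depends only on inner
products. -/
lemma LNCA_eq_log_sum_exp_inner {d : ℕ} {ι : Type*} (x y : EuclideanSpace ℝ (Fin d))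
    (Z : Finset ι) (f : ι → EuclideanSpace ℝ (Fin d)) (hf : ∀ z ∈ Z, ‖f z‖ = ‖y‖) :
    LNCA x y Z f = Real.log (∑ z ∈ Z, Real.exp (inner ℝ x (f z) - inner ℝ x y)) := by
  rw [LNCA, ← Real.log_inv, inv_div, Finset.sum_div]
  congr 1
  refine Finset.sum_congr rfl fun z hz => ?_
  rw [← Real.exp_sub, norm_sub_sq_real, norm_sub_sq_real, hf z hz]
  congr 1
  ring

/-- Jensen's inequality for scaled log-sum-exp. -/
lemma log_sum_exp_mul_le {ι : Type*} (Z : Finset ι) (hZ : Z.Nonempty) (a : ι → ℝ) {β : ℝ}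
    (hβ0 : 0 < β) (hβ1 : β ≤ 1) :
    Real.log (∑ z ∈ Z, Real.exp (β * a z)) ≤
      β * Real.log (∑ z ∈ Z, Real.exp (a z)) + (1 - β) * Real.log (Z.card : ℝ) := by
  have hcard : (0 : ℝ) < Z.card := by exact_mod_cast hZ.card_pos
  have hS : 0 < ∑ z ∈ Z, Real.exp (β * a z) := Finset.sum_pos (fun _ _ => Real.exp_pos _) hZ
  have hT : 0 < ∑ z ∈ Z, Real.exp (a z) := Finset.sum_pos (fun _ _ => Real.exp_pos _) hZ
  have key := Real.rpow_sum_le_const_mul_sum_rpow Z (fun z => Real.exp (β * a z))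
    ((one_le_inv₀ hβ0).2 hβ1)
  have hpow : ∀ z, Real.exp (β * a z) ^ β⁻¹ = Real.exp (a z) := fun z => by
    rw [← Real.exp_mul, mul_right_comm, mul_inv_cancel₀ hβ0.ne', one_mul]
  simp only [Real.abs_exp, hpow] at key
  have hlog := Real.log_le_log (Real.rpow_pos_of_pos hS _) key
  rw [Real.log_mul (Real.rpow_pos_of_pos hcard _).ne' hT.ne', Real.log_rpow hS,
    Real.log_rpow hcard] at hlog
  have hmul := mul_le_mul_of_nonneg_left hlog hβ0.le
  rw [mul_inv_cancel_left₀ hβ0.ne', mul_add, ← mul_assoc, mul_sub, mul_inv_cancel₀ hβ0.ne',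
    mul_one] at hmul
  linarith

/-- Let `x ∈ ℝ^d` with `‖x‖ = N_x`, `p_y ∈ ℝ^d`, and a finite nonempty
index set `Z` with proxies `p z ∈ ℝ^d`, with `‖p_y‖ = ‖p z‖ = N_p` for all `z ∈ Z`,
and suppose `β := 1/(N_x · N_p)` satisfies `0 < β ≤ 1`. Then
`L_NCA(x̂, p̂_y, p̂_Z) ≤ β · L_NCA(x, p_y, p_Z) + (1 − β) · log|Z|`,
where `v̂ = v/‖v‖`. -/
theorem stmt_10 (d : ℕ) {ι : Type*} (x py : EuclideanSpace ℝ (Fin d))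
    (Z : Finset ι) (hZ : Z.Nonempty) (p : ι → EuclideanSpace ℝ (Fin d))
    (Nx Np : ℝ) (hx : ‖x‖ = Nx) (hpy : ‖py‖ = Np) (hp : ∀ z ∈ Z, ‖p z‖ = Np)
    (β : ℝ) (hβ : β = 1 / (Nx * Np)) (hβ0 : 0 < β) (hβ1 : β ≤ 1) :
    LNCA ((‖x‖)⁻¹ • x) ((‖py‖)⁻¹ • py) Z (fun z => (‖p z‖)⁻¹ • p z) ≤
      β * LNCA x py Z p + (1 - β) * Real.log (Z.card : ℝ) := by
  have hne : Nx * Np ≠ 0 := by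
    rintro h
    simp [hβ, h] at hβ0
  have hNp : Np ≠ 0 := right_ne_zero_of_mul hne
  have hnorm : ∀ v : EuclideanSpace ℝ (Fin d), ‖v‖ = Np → ‖(‖v‖)⁻¹ • v‖ = 1 := fun v hv => by
    rw [norm_smul, norm_inv, norm_norm, inv_mul_cancel₀ (hv ▸ hNp)]
  rw [LNCA_eq_log_sum_exp_inner x py Z p fun z hz => (hp z hz).trans hpy.symm,
    LNCA_eq_log_sum_exp_inner _ _ Z _ fun z hz =>
      (hnorm _ (hp z hz)).trans (hnorm _ hpy).symm]
  refine le_of_eq_of_le ?_ (log_sum_exp_mul_le Z hZ _ hβ0 hβ1)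
  congr 1
  refine Finset.sum_congr rfl fun z hz => ?_
  rw [hp z hz, hpy, hx, hβ, one_div, mul_inv]
  simp only [real_inner_smul_left, real_inner_smul_right]
  congr 1
  ring
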